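/- Let G = (V, E) be a finite connected bipartite simple graph with bipartition V = A ⊔ B, |A| = |B|, and |V| ≥ 2. Then for every choice of positive edge weights w : E → (0, ∞): (i) the kernel of the normalized weighted Laplacian L' := I − D^{−1/2} A_w D^{−1/2} is spanned by the vector y with y_v := √(d_v), where d_v := Σ_{e ∋ v} w_e; and (ii) for no real number c does the vector c·y strictly separate the classes: it is never the case that c·y_v > c·y_u for all v ∈ A and u ∈ B, nor that c·y_v < c·y_u for all v ∈ A and u ∈ B. Hence no symmetric positive weighting can linearly separate the two classes in the normalized diffusion limit, for any initial condition. -/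

import Mathlib

/-- Maximum principle: a function on a finite connected graph that is harmonic with respect to
positive edge weights is constant. -/
theorem SimpleGraph.Connected.eq_of_weighted_harmonic {V : Type*} [Fintype V]
    {G : SimpleGraph V} [DecidableRel G.Adj] (hG : G.Connected) {w : V → V → ℝ}
    (hw : ∀ u v, G.Adj u v → 0 < w u v) {z : V → ℝ}
    (hz : ∀ v, ∑ u, (if G.Adj v u then w v u * (z v - z u) else 0) = 0) (a b : V) :
    z a = z b := by
  have : Nonempty V := ⟨a⟩
  obtain ⟨m, hm⟩ := Finite.exists_max z
  have hstep : ∀ v u, G.Adj v u → z v = z m → z u = z m := by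
    intro v u hvu hv
    have hnonneg : ∀ u ∈ Finset.univ,
        0 ≤ if G.Adj v u then w v u * (z v - z u) else 0 := by
      intro u _
      split_ifs with h
      · exact mul_nonneg (hw v u h).le (by linarith [hm u])
      · exact le_rfl
    have h := (Finset.sum_eq_zero_iff_of_nonneg hnonneg).1 (hz v) u (Finset.mem_univ u)
    rw [if_pos hvu] at h
    rcases mul_eq_zero.1 h with h | h
    · exact absurd h (hw v u hvu).ne'
    · linarith
  have hmax : ∀ v, z v = z m := by
    intro v
    obtain ⟨p⟩ := hG.preconnected m v
    have key : ∀ {x y : V}, G.Walk x y → z x = z m → z y = z m := by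
      intro x y p
      induction p with
      | nil => exact id
      | cons h _ ih => exact fun hx => ih (hstep _ _ h hx)
    exact key p rfl
  rw [hmax a, hmax b]

/-- Two nonempty finite sets of the same size over which `f` has the same sum are not strictly
ordered by `f`. -/
theorem Finset.exists_le_of_card_eq_of_sum_eq {V : Type*} {A B : Finset V} {f : V → ℝ}
    (hA : A.Nonempty) (hcard : A.card = B.card) (hsum : ∑ v ∈ A, f v = ∑ v ∈ B, f v) :
    ∃ v ∈ A, ∃ u ∈ B, f v ≤ f u := by
  by_contra! h
  have hB : B.Nonempty := by rwa [← Finset.card_pos, ← hcard, Finset.card_pos]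
  have hpos : 0 < ∑ v ∈ A, ∑ u ∈ B, (f v - f u) :=
    Finset.sum_pos (fun v hv => Finset.sum_pos (fun u hu => sub_pos.2 (h v hv u hu)) hB) hA
  simp [Finset.sum_sub_distrib, ← Finset.mul_sum, hcard, hsum] at hpos

/-- No multiple of `√f` strictly separates two nonempty finite sets of the same size over which
`f` has the same sum. -/
theorem Finset.not_forall_mul_sqrt_lt {V : Type*} {A B : Finset V} {f : V → ℝ}
    (hA : A.Nonempty) (hcard : A.card = B.card) (hsum : ∑ v ∈ A, f v = ∑ v ∈ B, f v) (c : ℝ) :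
    ¬ ∀ v ∈ A, ∀ u ∈ B, c * √(f u) < c * √(f v) := by
  intro h
  have hB : B.Nonempty := by rwa [← Finset.card_pos, ← hcard, Finset.card_pos]
  rcases le_total 0 c with hc | hc
  · obtain ⟨v, hv, u, hu, hvu⟩ := Finset.exists_le_of_card_eq_of_sum_eq hA hcard hsum
    exact (h v hv u hu).not_ge (mul_le_mul_of_nonneg_left (Real.sqrt_le_sqrt hvu) hc)
  · obtain ⟨u, hu, v, hv, huv⟩ := Finset.exists_le_of_card_eq_of_sum_eq hB hcard.symm hsum.symm
    exact (h v hv u hu).not_ge (mul_le_mul_of_nonpos_left (Real.sqrt_le_sqrt huv) hc)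

/-- The weighted degrees on the two sides of a bipartite graph have the same sum. -/
theorem SimpleGraph.sum_weighted_degree_eq_compl {V : Type*} [Fintype V] [DecidableEq V]
    {G : SimpleGraph V} [DecidableRel G.Adj] {A : Finset V}
    (hbip : ∀ u v : V, G.Adj u v → (u ∈ A ↔ v ∉ A)) {w : V → V → ℝ}
    (hsymm : ∀ u v, w u v = w v u) :
    ∑ v ∈ A, ∑ u, (if G.Adj v u then w v u else 0) =
      ∑ v ∈ Aᶜ, ∑ u, (if G.Adj v u then w v u else 0) := by
  have hl : ∀ v ∈ A, ∑ u, (if G.Adj v u then w v u else 0) =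
      ∑ u ∈ Aᶜ, (if G.Adj v u then w v u else 0) := by
    intro v hv
    refine (Finset.sum_subset (Finset.subset_univ _) fun u _ hu => if_neg fun h => ?_).symm
    exact hu (Finset.mem_compl.2 ((hbip v u h).1 hv))
  have hr : ∀ v ∈ Aᶜ, ∑ u, (if G.Adj v u then w v u else 0) =
      ∑ u ∈ A, (if G.Adj v u then w v u else 0) := by
    intro v hv
    refine (Finset.sum_subset (Finset.subset_univ _) fun u _ hu => if_neg fun h => ?_).symm
    exact Finset.mem_compl.1 hv ((hbip v u h).2 hu)
  rw [Finset.sum_congr rfl hl, Finset.sum_congr rfl hr, Finset.sum_comm]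
  simp only [G.adj_comm, hsymm]

/-- In a connected graph with at least two vertices and positive edge weights, every weighted
degree is positive. -/
theorem SimpleGraph.Connected.weighted_degree_pos {V : Type*} [Fintype V]
    {G : SimpleGraph V} [DecidableRel G.Adj] (hG : G.Connected) [Nontrivial V]
    {w : V → V → ℝ} (hw : ∀ u v, G.Adj u v → 0 < w u v) (v : V) :
    0 < ∑ u, if G.Adj v u then w v u else 0 := by
  obtain ⟨u, hu⟩ := hG.preconnected.exists_adj_of_nontrivial v
  refine Finset.sum_pos' (fun x _ => ?_) ⟨u, Finset.mem_univ u, by simpa [hu] using hw v u hu⟩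
  split_ifs with h
  · exact (hw v x h).le
  · exact le_rfl


/-- Let `G` be a finite connected bipartite simple graph with bipartition `V = A ⊔ Aᶜ`,
`|A| = |Aᶜ|`, and at least two vertices.  Then for every choice of positive symmetric edge
weights `w`, with weighted degrees `d v = ∑_{u ~ v} w v u`, `y v = √(d v)`, and normalized
weighted Laplacian `L' = I − D^{−1/2} A_w D^{−1/2}`:
(i) `ker L'` is spanned by `y`; and (ii) for no real `c` does `c • y` strictly separate the
classes: neither `c * y v > c * y u` for all `v ∈ A, u ∈ Aᶜ`, nor `c * y v < c * y u` for
all `v ∈ A, u ∈ Aᶜ`.  Hence no symmetric positive weighting can linearly separate the two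
classes in the normalized diffusion limit, for any initial condition. -/
theorem stmt6 {V : Type*} [Fintype V] [DecidableEq V]
    (G : SimpleGraph V) [DecidableRel G.Adj] (hG : G.Connected)
    (hcard : 2 ≤ Fintype.card V)
    (A : Finset V)
    (hbip : ∀ u v : V, G.Adj u v → (u ∈ A ↔ v ∉ A))
    (hsize : A.card = Aᶜ.card) :
    ∀ w : V → V → ℝ,
      (∀ u v, w u v = w v u) →
      (∀ u v, G.Adj u v → 0 < w u v) →
      ∀ (d y : V → ℝ) (L' : Matrix V V ℝ),
        (∀ v, d v = ∑ u, if G.Adj v u then w v u else 0) →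
        (∀ v, y v = Real.sqrt (d v)) →
        (L' = 1 - Matrix.of (fun v u =>
          if G.Adj v u then w v u / (Real.sqrt (d v) * Real.sqrt (d u)) else 0)) →
        (LinearMap.ker L'.mulVecLin = Submodule.span ℝ {y}) ∧
        (∀ c : ℝ,
          (¬ ∀ v ∈ A, ∀ u ∈ Aᶜ, c * y u < c * y v) ∧
          (¬ ∀ v ∈ A, ∀ u ∈ Aᶜ, c * y v < c * y u)) := by
  intro w hsymm hw d y L' hd hy hL
  have : Nontrivial V := Fintype.one_lt_card_iff_nontrivial.1 hcard
  have hdpos : ∀ v, 0 < d v := fun v => hd v ▸ hG.weighted_degree_pos hw v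
  have hspos : ∀ v, 0 < √(d v) := fun v => Real.sqrt_pos.2 (hdpos v)
  have hmul : ∀ (z : V → ℝ) (v : V), √(d v) * (L'.mulVec fun u => √(d u) * z u) v =
      ∑ u, if G.Adj v u then w v u * (z v - z u) else 0 := by
    intro z v
    have hleft : √(d v) * (√(d v) * z v) = ∑ u, (if G.Adj v u then w v u else 0) * z v := by
      rw [← Finset.sum_mul, ← hd, ← mul_assoc, Real.mul_self_sqrt (hdpos v).le]
    rw [hL, Matrix.sub_mulVec, Matrix.one_mulVec, Pi.sub_apply, mul_sub, hleft]
    simp only [Matrix.mulVec, dotProduct, Matrix.of_apply]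
    rw [Finset.mul_sum, ← Finset.sum_sub_distrib]
    refine Finset.sum_congr rfl fun u _ => ?_
    have hv := (hspos v).ne'
    have hu := (hspos u).ne'
    split_ifs
    · field_simp
    · simp
  have hyd : y = fun v => √(d v) := funext hy
  refine ⟨?_, fun c => ?_⟩
  · ext x
    rw [LinearMap.mem_ker, Matrix.mulVecLin_apply, Submodule.mem_span_singleton]
    constructor
    · intro hx
      have hxz : (fun u => √(d u) * (x u / √(d u))) = x :=
        funext fun u => mul_div_cancel₀ _ (hspos u).ne'
      have hconst := hG.eq_of_weighted_harmonic hw (z := fun u => x u / √(d u)) fun v => by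
        have h := hmul (fun u => x u / √(d u)) v
        rwa [hxz, hx, Pi.zero_apply, mul_zero, eq_comm] at h
      obtain ⟨a⟩ := hG.nonempty
      refine ⟨x a / √(d a), funext fun v => ?_⟩
      have h : x a / √(d a) = x v / √(d v) := hconst a v
      rw [Pi.smul_apply, smul_eq_mul, hy, h, div_mul_cancel₀ _ (hspos v).ne']
    · rintro ⟨c, rfl⟩
      funext v
      have h := hmul (fun _ => c) v
      simp only [sub_self, mul_zero, ite_self, Finset.sum_const_zero] at h
      have hc : c • y = fun u => √(d u) * c := by
        rw [hyd]
        exact funext fun u => mul_comm _ _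
      rw [hc]
      exact (mul_eq_zero.1 h).resolve_left (hspos v).ne'
  · have hA : A.Nonempty := by
      rw [← Finset.card_pos]
      have := A.card_add_card_compl
      omega
    have hAc : Aᶜ.Nonempty := by rwa [← Finset.card_pos, ← hsize, Finset.card_pos]
    have hsum : ∑ v ∈ A, d v = ∑ v ∈ Aᶜ, d v := by
      simp only [hd]
      exact G.sum_weighted_degree_eq_compl hbip hsymm
    simp only [hy]
    exact ⟨Finset.not_forall_mul_sqrt_lt hA hsize hsum c, fun h =>
      Finset.not_forall_mul_sqrt_lt hAc hsize.symm hsum.symm c fun u hu v hv => h v hv u hu⟩
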